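/- arXiv:2304.05808 — 2 statements merged into one kernel-verified Lean document; each statement's English description precedes it below -/
import Mathlib

section
/- Let n ≥ 3 and let g(x', x_n) = c(x', x_n)·blockdiag(ĝ(x'), 1) on ℝ^n as in the setup. Let u ∈ C²(ℝ^{n−1}), regarded as a function on ℝ^n independent of x_n. Then at every point x = (x', x_n) ∈ ℝ^n: (∇²_g u)(∇_ĝ u, ∇_ĝ u) = (∇²_ĝ u)(∇_ĝ u, ∇_ĝ u) − (1/(2c(x))) Σ_{i,a=1}^{n−1} ĝ^{ia}(x') ∂_{x_i}c(x) ∂_{x_a}u(x') · |∇_ĝ u(x')|²_ĝ, where (∇²_g u)(∇_ĝ u, ∇_ĝ u) = (∂²_{x_i x_j}u − Γ(g)^m_{ij}∂_{x_m}u) ĝ^{ia}∂_{x_a}u ĝ^{jb}∂_{x_b}u and (∇²_ĝ u)(∇_ĝ u, ∇_ĝ u) = (∂²_{x_i x_j}u − Γ(ĝ)^m_{ij}∂_{x_m}u) ĝ^{ia}∂_{x_a}u ĝ^{jb}∂_{x_b}u, with i, j, a, b, m summed from 1 to n−1 (for Γ(g) the index m runs to n, but ∂_{x_n}u = 0). 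-/
noncomputable section

open scoped BigOperators

/-- Partial derivative `∂_i f` at `x`. -/
def pd {k : ℕ} {E : Type*} [NormedAddCommGroup E] [NormedSpace ℝ E]
    (i : Fin k) (f : (Fin k → ℝ) → E) (x : Fin k → ℝ) : E :=
  fderiv ℝ f x (Pi.single i 1)

/-- Christoffel symbols `Γ(h)^m_{ij} = ½ h^{ml}(∂_i h_{jl} + ∂_j h_{il} − ∂_l h_{ij})`. -/
def christoffel {k : ℕ} (h : (Fin k → ℝ) → Matrix (Fin k) (Fin k) ℝ)
    (m i j : Fin k) (x : Fin k → ℝ) : ℝ :=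
  (1 / 2) * ∑ l : Fin k, (h x)⁻¹ m l *
    (pd i (fun y => h y j l) x + pd j (fun y => h y i l) x - pd l (fun y => h y i j) x)

/-- Laplace–Beltrami operator `Δ_h f = h^{ij}(∂²_{ij} f − Γ(h)^m_{ij} ∂_m f)`. -/
def laplaceB {k : ℕ} (h : (Fin k → ℝ) → Matrix (Fin k) (Fin k) ℝ)
    (f : (Fin k → ℝ) → ℝ) (x : Fin k → ℝ) : ℝ :=
  ∑ i : Fin k, ∑ j : Fin k, (h x)⁻¹ i j *
    (pd i (pd j f) x - ∑ l : Fin k, christoffel h l i j x * pd l f x)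

/-- Hessian `(∇²_h f)_{ij} = ∂²_{ij} f − Γ(h)^m_{ij} ∂_m f`. -/
def hessian {k : ℕ} (h : (Fin k → ℝ) → Matrix (Fin k) (Fin k) ℝ)
    (f : (Fin k → ℝ) → ℝ) (i j : Fin k) (x : Fin k → ℝ) : ℝ :=
  pd i (pd j f) x - ∑ l : Fin k, christoffel h l i j x * pd l f x

/-- Gradient components `(∇_h f)^i = h^{ij} ∂_j f`. -/
def gradC {k : ℕ} (h : (Fin k → ℝ) → Matrix (Fin k) (Fin k) ℝ)
    (f : (Fin k → ℝ) → ℝ) (i : Fin k) (x : Fin k → ℝ) : ℝ :=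
  ∑ j : Fin k, (h x)⁻¹ i j * pd j f x

/-- Squared gradient norm `|∇_h f|²_h = h^{ij} ∂_i f ∂_j f`. -/
def gradSq {k : ℕ} (h : (Fin k → ℝ) → Matrix (Fin k) (Fin k) ℝ)
    (f : (Fin k → ℝ) → ℝ) (x : Fin k → ℝ) : ℝ :=
  ∑ i : Fin k, ∑ j : Fin k, (h x)⁻¹ i j * pd i f x * pd j f x

/-- Divergence `div_h a = Σ_i (∂_i a^i + Σ_j a^j Γ(h)^i_{ij})`. -/
def divg {k : ℕ} (h : (Fin k → ℝ) → Matrix (Fin k) (Fin k) ℝ)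
    (a : Fin k → (Fin k → ℝ) → ℝ) (x : Fin k → ℝ) : ℝ :=
  ∑ i : Fin k, (pd i (a i) x + ∑ j : Fin k, a j x * christoffel h i i j x)

/-- The projection `x ↦ x'` onto the first `m` coordinates. -/
def proj {m : ℕ} (x : Fin (m + 1) → ℝ) : Fin m → ℝ := x ∘ Fin.castSucc

/-- The metric `g(x', x_n) = c(x', x_n) · blockdiag(ĝ(x'), 1)` on `ℝ^{m+1}`. -/
def gMet {m : ℕ} (c : (Fin (m + 1) → ℝ) → ℝ)
    (ghat : (Fin m → ℝ) → Matrix (Fin m) (Fin m) ℝ)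
    (x : Fin (m + 1) → ℝ) : Matrix (Fin (m + 1)) (Fin (m + 1)) ℝ :=
  Matrix.of fun i j =>
    c x * (if hi : (i : ℕ) < m then
             (if hj : (j : ℕ) < m then ghat (proj x) ⟨i, hi⟩ ⟨j, hj⟩ else 0)
           else (if (j : ℕ) < m then 0 else 1))

/-- A function `u` on `ℝ^m`, regarded as a function on `ℝ^{m+1}` independent of the last
coordinate. -/
def ext {m : ℕ} (u : (Fin m → ℝ) → ℝ) (x : Fin (m + 1) → ℝ) : ℝ := u (proj x)

def projL (m : ℕ) : (Fin (m + 1) → ℝ) →L[ℝ] (Fin m → ℝ) :=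
  ContinuousLinearMap.pi fun i => ContinuousLinearMap.proj (Fin.castSucc i)

theorem projL_apply {m : ℕ} (x : Fin (m + 1) → ℝ) : projL m x = proj x := rfl

theorem projL_single {m : ℕ} (i : Fin m) :
    projL m (Pi.single (Fin.castSucc i) 1) = Pi.single i 1 := by
  ext j
  simp [projL, Pi.single_apply]

theorem projL_single_last {m : ℕ} :
    projL m (Pi.single (Fin.last m) 1) = 0 := by
  ext j
  simp [projL, Pi.single_apply, Fin.castSucc_ne_last]

theorem fderiv_comp_proj {m : ℕ} (f : (Fin m → ℝ) → ℝ) (x : Fin (m + 1) → ℝ)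
    (hf : DifferentiableAt ℝ f (proj x)) :
    HasFDerivAt (fun y => f (proj y)) ((fderiv ℝ f (proj x)).comp (projL m)) x := by
  have h1 : HasFDerivAt (fun y : Fin (m + 1) → ℝ => projL m y) (projL m) x :=
    (projL m).hasFDerivAt
  exact HasFDerivAt.comp x (g := f) (f := fun y => projL m y) hf.hasFDerivAt h1

theorem pd_comp_proj {m : ℕ} (f : (Fin m → ℝ) → ℝ) (x : Fin (m + 1) → ℝ)
    (hf : DifferentiableAt ℝ f (proj x)) (i : Fin m) :
    pd (Fin.castSucc i) (fun y => f (proj y)) x = pd i f (proj x) := by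
  unfold pd
  rw [(fderiv_comp_proj f x hf).fderiv]
  simp [projL_single]

theorem pd_last_comp_proj {m : ℕ} (f : (Fin m → ℝ) → ℝ) (x : Fin (m + 1) → ℝ)
    (hf : DifferentiableAt ℝ f (proj x)) :
    pd (Fin.last m) (fun y => f (proj y)) x = 0 := by
  unfold pd
  rw [(fderiv_comp_proj f x hf).fderiv]
  simp [projL_single_last]

theorem pd_mul_comp_proj {m : ℕ} (c : (Fin (m + 1) → ℝ) → ℝ) (f : (Fin m → ℝ) → ℝ)
    (x : Fin (m + 1) → ℝ) (hc : DifferentiableAt ℝ c x)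
    (hf : DifferentiableAt ℝ f (proj x)) (i : Fin m) :
    pd (Fin.castSucc i) (fun y => c y * f (proj y)) x
      = pd (Fin.castSucc i) c x * f (proj x) + c x * pd i f (proj x) := by
  rw [← pd_comp_proj f x hf]
  unfold pd
  rw [fderiv_fun_mul hc (fderiv_comp_proj f x hf).differentiableAt]
  simp
  ring

section
variable {m : ℕ} (c : (Fin (m + 1) → ℝ) → ℝ)
    (G : (Fin m → ℝ) → Matrix (Fin m) (Fin m) ℝ) (x : Fin (m + 1) → ℝ)

theorem gMet_cc (i j : Fin m) :
    gMet c G x (Fin.castSucc i) (Fin.castSucc j) = c x * G (proj x) i j := by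
  simp [gMet]

theorem gMet_cl (i : Fin m) : gMet c G x (Fin.castSucc i) (Fin.last m) = 0 := by
  simp [gMet]

theorem gMet_lc (i : Fin m) : gMet c G x (Fin.last m) (Fin.castSucc i) = 0 := by
  simp [gMet]

theorem gMet_ll : gMet c G x (Fin.last m) (Fin.last m) = c x := by
  simp [gMet]

theorem gMet_inv (hc : c x ≠ 0) (hG : IsUnit (G (proj x)).det) :
    (gMet c G x)⁻¹ = gMet (fun y => (c y)⁻¹) (fun y => (G y)⁻¹) x := by
  apply Matrix.inv_eq_right_inv
  have h := Matrix.mul_nonsing_inv _ hG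
  ext i j
  rw [Matrix.mul_apply, Fin.sum_univ_castSucc]
  refine Fin.lastCases ?_ (fun i => ?_) i <;> refine Fin.lastCases ?_ (fun j => ?_) j
  · simp [gMet_cc, gMet_cl, gMet_lc, gMet_ll, hc]
  · simp [gMet_cc, gMet_cl, gMet_lc, gMet_ll, Matrix.one_apply, (Fin.castSucc_ne_last j).symm]
  · simp [gMet_cc, gMet_cl, gMet_lc, gMet_ll, Matrix.one_apply, Fin.castSucc_ne_last]
  · have h2 := congrFun (congrFun h i) j
    rw [Matrix.mul_apply] at h2
    simp only [gMet_cc, gMet_cl, gMet_lc, mul_zero, add_zero]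
    rw [Matrix.one_apply] at *
    simp only [Fin.castSucc_inj]
    rw [← h2]
    refine Finset.sum_congr rfl fun k _ => ?_
    field_simp
end

theorem gradC_contract {m : ℕ} (G : (Fin m → ℝ) → Matrix (Fin m) (Fin m) ℝ)
    (y : Fin m → ℝ) (hG : (G y).PosDef) (u : (Fin m → ℝ) → ℝ) (j : Fin m) :
    ∑ k, G y j k * gradC G u k y = pd j u y := by
  have h := Matrix.mul_nonsing_inv _ ((Matrix.isUnit_iff_isUnit_det _).1 hG.isUnit)
  have h3 : (G y).mulVec ((G y)⁻¹.mulVec fun k => pd k u y) = fun k => pd k u y := by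
    rw [Matrix.mulVec_mulVec, h, Matrix.one_mulVec]
  exact congrFun h3 j

theorem sym_inv {m : ℕ} (M : Matrix (Fin m) (Fin m) ℝ) (hG : M.PosDef) (i j : Fin m) :
    M⁻¹ i j = M⁻¹ j i := by
  have := hG.isHermitian.inv.apply i j
  simpa using this.symm

theorem christoffel_sum {m : ℕ} (G : (Fin m → ℝ) → Matrix (Fin m) (Fin m) ℝ)
    (hG : ∀ i j, Differentiable ℝ fun y => G y i j)
    (hpd : ∀ y, (G y).PosDef) (c : (Fin (m + 1) → ℝ) → ℝ) (hc : Differentiable ℝ c)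
    (hcpos : ∀ x, 0 < c x) (x : Fin (m + 1) → ℝ) (l i j : Fin m) :
    christoffel (gMet c G) l.castSucc i.castSucc j.castSucc x
      = christoffel G l i j (proj x) + (1 / (2 * c x)) * ∑ k, (G (proj x))⁻¹ l k *
        (pd i.castSucc c x * G (proj x) j k + pd j.castSucc c x * G (proj x) i k
          - pd k.castSucc c x * G (proj x) i j) := by
  have hx := (hcpos x).ne'
  unfold christoffel
  rw [gMet_inv c G x hx ((Matrix.isUnit_iff_isUnit_det _).1 (hpd _).isUnit),
    Fin.sum_univ_castSucc]
  simp only [gMet_cc, gMet_cl, zero_mul, add_zero]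
  have e : ∀ a b k : Fin m, pd k.castSucc (fun y => c y * G (proj y) a b) x
      = pd k.castSucc c x * G (proj x) a b + c x * pd k (fun y => G y a b) (proj x) :=
    fun a b k => pd_mul_comp_proj c (fun y => G y a b) x (hc x) (hG a b _) k
  simp only [e]
  rw [Finset.mul_sum, Finset.mul_sum, Finset.mul_sum, ← Finset.sum_add_distrib]
  refine Finset.sum_congr rfl fun k _ => ?_
  field_simp
  ring

theorem hessian_gMet {m : ℕ} (G : (Fin m → ℝ) → Matrix (Fin m) (Fin m) ℝ)
    (hG : ∀ i j, Differentiable ℝ fun y => G y i j)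
    (hpd : ∀ y, (G y).PosDef) (c : (Fin (m + 1) → ℝ) → ℝ) (hc : Differentiable ℝ c)
    (hcpos : ∀ x, 0 < c x) (u : (Fin m → ℝ) → ℝ) (hu : ContDiff ℝ 2 u)
    (x : Fin (m + 1) → ℝ) (i j : Fin m) :
    hessian (gMet c G) (ext u) i.castSucc j.castSucc x
      = hessian G u i j (proj x) - (1 / (2 * c x)) *
        (pd i.castSucc c x * pd j u (proj x) + pd j.castSucc c x * pd i u (proj x)
          - (∑ k, pd k.castSucc c x * gradC G u k (proj x)) * G (proj x) i j) := by
  have hud : Differentiable ℝ u := hu.differentiable (by norm_num)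
  have hpdu : ∀ j, Differentiable ℝ (pd j u) := fun j => by
    have h1 : ContDiff ℝ 1 (fderiv ℝ u) := hu.fderiv_right (by norm_num)
    exact (h1.differentiable (by norm_num)).clm_apply (differentiable_const _)
  have e1 : ∀ j : Fin m, pd j.castSucc (ext u) = fun y => pd j u (proj y) := fun j => by
    funext y
    exact pd_comp_proj u y (hud _) j
  have e2 : pd (Fin.last m) (ext u) x = 0 := pd_last_comp_proj u x (hud _)
  unfold hessian
  rw [Fin.sum_univ_castSucc, e2]
  simp only [e1, mul_zero, add_zero]
  rw [pd_comp_proj _ x (hpdu j _) i]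
  simp only [christoffel_sum G hG hpd c hc hcpos, add_mul, Finset.sum_add_distrib]
  rw [← sub_sub]
  congr 1
  rw [← gradC_contract G (proj x) (hpd _) u j, ← gradC_contract G (proj x) (hpd _) u i]
  have e3 : ∀ k, gradC G u k (proj x) = ∑ l, (G (proj x))⁻¹ l k * pd l u (proj x) := fun k =>
    Finset.sum_congr rfl fun l _ => by rw [sym_inv _ (hpd _)]
  simp only [mul_assoc]
  rw [← Finset.mul_sum]
  congr 1
  simp only [Finset.sum_mul]
  rw [Finset.sum_comm, Finset.mul_sum, Finset.mul_sum, ← Finset.sum_add_distrib,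
    ← Finset.sum_sub_distrib]
  refine Finset.sum_congr rfl fun k _ => ?_
  rw [e3]
  simp only [Finset.mul_sum, Finset.sum_mul]
  rw [← Finset.sum_add_distrib, ← Finset.sum_sub_distrib]
  refine Finset.sum_congr rfl fun l _ => ?_
  ring

/-- `(∇²_g u)(∇_ĝ u, ∇_ĝ u) = (∇²_ĝ u)(∇_ĝ u, ∇_ĝ u)
  − (1/(2c)) Σ_{i,a} ĝ^{ia} ∂_i c ∂_a u · |∇_ĝ u|²_ĝ`, where `n = m+1`. -/
theorem hessian_gMet_contraction_eq (m : ℕ) (hm : 2 ≤ m)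
    (ghat : (Fin m → ℝ) → Matrix (Fin m) (Fin m) ℝ)
    (hghat : ∀ i j, ContDiff ℝ (⊤ : ℕ∞) fun x' => ghat x' i j)
    (hpd : ∀ x', (ghat x').PosDef)
    (c : (Fin (m + 1) → ℝ) → ℝ)
    (hc : ContDiff ℝ (⊤ : ℕ∞) c) (hcpos : ∀ x, 0 < c x)
    (u : (Fin m → ℝ) → ℝ) (hu : ContDiff ℝ 2 u)
    (x : Fin (m + 1) → ℝ) :
    ∑ i : Fin m, ∑ j : Fin m,
        hessian (gMet c ghat) (ext u) (Fin.castSucc i) (Fin.castSucc j) x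
          * gradC ghat u i (proj x) * gradC ghat u j (proj x)
      = (∑ i : Fin m, ∑ j : Fin m,
            hessian ghat u i j (proj x)
              * gradC ghat u i (proj x) * gradC ghat u j (proj x))
        - (1 / (2 * c x)) *
            (∑ i : Fin m, ∑ a : Fin m,
              (ghat (proj x))⁻¹ i a * pd (Fin.castSucc i) c x * pd a u (proj x))
            * gradSq ghat u (proj x) := by
  have hG : ∀ i j, Differentiable ℝ fun y => ghat y i j := fun i j =>
    (hghat i j).differentiable (by simp)
  have hcd : Differentiable ℝ c := hc.differentiable (by simp)
  simp only [hessian_gMet ghat hG hpd c hcd hcpos u hu]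
  have e3 : ∑ i : Fin m, ∑ a : Fin m,
      (ghat (proj x))⁻¹ i a * pd (Fin.castSucc i) c x * pd a u (proj x)
      = ∑ k, pd k.castSucc c x * gradC ghat u k (proj x) := by
    refine Finset.sum_congr rfl fun i _ => ?_
    rw [gradC, Finset.mul_sum]
    refine Finset.sum_congr rfl fun a _ => ?_
    ring
  have e4 : gradSq ghat u (proj x) = ∑ j, pd j u (proj x) * gradC ghat u j (proj x) := by
    refine Finset.sum_congr rfl fun i _ => ?_
    rw [gradC, Finset.mul_sum]
    refine Finset.sum_congr rfl fun a _ => ?_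
    ring
  have e5 : ∑ i, ∑ j, ghat (proj x) i j * gradC ghat u i (proj x) * gradC ghat u j (proj x)
      = gradSq ghat u (proj x) := by
    rw [e4]
    refine Finset.sum_congr rfl fun i _ => ?_
    rw [← gradC_contract ghat (proj x) (hpd _) u i, Finset.sum_mul]
    refine Finset.sum_congr rfl fun a _ => ?_
    ring
  rw [e3]
  set w := fun k => gradC ghat u k (proj x) with hw
  set p := fun k => pd k u (proj x) with hp
  set q := fun k : Fin m => pd k.castSucc c x with hq
  set Q := ∑ k, pd k.castSucc c x * gradC ghat u k (proj x) with hQ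
  set S := gradSq ghat u (proj x) with hS
  have e6 : ∑ i, ∑ j, q i * p j * w i * w j = Q * S := by
    rw [e4, hQ, Finset.sum_mul_sum]
    refine Finset.sum_congr rfl fun i _ => Finset.sum_congr rfl fun j _ => ?_
    simp only [hq, hp, hw]
    ring
  have e7 : ∑ i, ∑ j, q j * p i * w i * w j = Q * S := by
    rw [← e6, Finset.sum_comm]
    refine Finset.sum_congr rfl fun i _ => Finset.sum_congr rfl fun j _ => ?_
    ring
  have e8 : 1 / (2 * c x) * Q * S = ∑ i, ∑ j, 1 / (2 * c x) *
      (q i * p j * w i * w j + q j * p i * w i * w j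
        - Q * (ghat (proj x) i j * w i * w j)) := by
    simp only [← Finset.mul_sum, Finset.sum_sub_distrib, Finset.sum_add_distrib]
    rw [e6, e7]
    simp only [hw]
    rw [e5]
    ring
  rw [e8]
  simp only [← Finset.sum_sub_distrib]
  refine Finset.sum_congr rfl fun i _ => Finset.sum_congr rfl fun j _ => ?_
  simp only [hq, hp, hw]
  ring
end
end

section
/- Let n ≥ 3 and let g(x', x_n) = c(x', x_n)·blockdiag(ĝ(x'), 1) on ℝ^n as in the setup, and assume ∂_{x_n}c(x', 0) = 0 and ∂_{x_k}∂_{x_n}c(x', 0) = 0 for all x' ∈ ℝ^{n−1} and all k = 1, …, n−1. Let ε = (ε_1, …, ε_N) ↦ u_ε be a family of functions ℝ^{n−1} → ℝ, smooth jointly in (x', ε) for ε near 0 in ℝ^N, with u_0 ≡ 0; let v^k := ∂_{ε_k}u_ε|_{ε=0}, v^l := ∂_{ε_l}u_ε|_{ε=0}, and w := ∂²_{ε_k ε_l}u_ε|_{ε=0} for two distinct indices k ≠ l. Define F(x', u, ∇_g u, ∇²_g u) := (−Δ_ĝ u + ((1−n)/(2c)) ĝ^{mr}∂_{x_r}c ∂_{x_m}u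 + ((n−1)/(2c)) ∂_{x_n}c)(1 + |∇_ĝ u|²_ĝ) + (∇²_ĝ u)(∇_ĝ u, ∇_ĝ u), with c and its derivatives evaluated at (x', u_ε(x')). Then for every x' ∈ ℝ^{n−1}: ∂²_{ε_k ε_l}[F(x', u_ε, ∇_g u_ε, ∇²_g u_ε)]|_{ε=0} = −Δ_ĝ w + ((n−1)/(2c(x', 0)))(∂³_{x_n}c(x', 0)·v^k v^l + ∂²_{x_n}c(x', 0)·w) + ((1−n)/(2c(x', 0))) Σ_{i,j=1}^{n−1} ĝ^{ij}(x') ∂_{x_i}c(x', 0) ∂_{x_j}w. -/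
noncomputable section

open scoped BigOperators

/-- The quasilinear minimal surface operator
`F = (−Δ_ĝ u + ((1−n)/(2c)) ĝ^{mr} ∂_r c ∂_m u + ((n−1)/(2c)) ∂_n c)(1 + |∇_ĝ u|²_ĝ)
  + (∇²_ĝ u)(∇_ĝ u, ∇_ĝ u)`, where `n = m+1`, the spatial point is `x'` and the conformal
factor `c` and its derivatives are evaluated at the point `x ∈ ℝ^{m+1}`. -/
def Fop {m : ℕ} (c : (Fin (m + 1) → ℝ) → ℝ)
    (ghat : (Fin m → ℝ) → Matrix (Fin m) (Fin m) ℝ)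
    (u : (Fin m → ℝ) → ℝ) (x' : Fin m → ℝ) (x : Fin (m + 1) → ℝ) : ℝ :=
  (-(laplaceB ghat u x')
      + ((1 - ((m : ℝ) + 1)) / (2 * c x)) *
          ∑ mm : Fin m, ∑ r : Fin m, (ghat x')⁻¹ mm r * pd (Fin.castSucc r) c x * pd mm u x'
      + ((((m : ℝ) + 1) - 1) / (2 * c x)) * pd (Fin.last m) c x)
    * (1 + gradSq ghat u x')
  + ∑ i : Fin m, ∑ j : Fin m,
      hessian ghat u i j x' * gradC ghat u i x' * gradC ghat u j x'

/-- Second order jet at `0` in directions `k`, `l`. -/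
structure Jet {N : ℕ} (k l : Fin N) (f : (Fin N → ℝ) → ℝ) (a b c d : ℝ) : Prop where
  smooth : ContDiffAt ℝ 2 f 0
  val : f 0 = a
  d1 : pd k f 0 = b
  d2 : pd l f 0 = c
  d12 : pd k (pd l f) 0 = d

theorem two_le_top : (2 : WithTop ℕ∞) ≤ ((⊤ : ℕ∞) : WithTop ℕ∞) :=
  WithTop.coe_le_coe.2 (le_top : (2 : ℕ∞) ≤ ⊤)

theorem pd_contDiffAt {N : ℕ} {l : Fin N} {f : (Fin N → ℝ) → ℝ} {x : Fin N → ℝ}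
    (hf : ContDiffAt ℝ 2 f x) : ContDiffAt ℝ 1 (pd l f) x :=
  (hf.fderiv_right (m := 1) (by norm_num)).clm_apply contDiffAt_const

theorem ev_diff {N : ℕ} {f : (Fin N → ℝ) → ℝ} {x : Fin N → ℝ}
    (hf : ContDiffAt ℝ 2 f x) : ∀ᶠ y in nhds x, DifferentiableAt ℝ f y := by
  filter_upwards [hf.eventually (by simp)] with y hy
  exact hy.differentiableAt (by norm_num)

theorem pd_congr {N : ℕ} {l : Fin N} {f g : (Fin N → ℝ) → ℝ} {x : Fin N → ℝ}
    (h : f =ᶠ[nhds x] g) : pd l f x = pd l g x := by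
  unfold pd; rw [h.fderiv_eq]

theorem pd_add {N : ℕ} {l : Fin N} {f g : (Fin N → ℝ) → ℝ} {x : Fin N → ℝ}
    (hf : DifferentiableAt ℝ f x) (hg : DifferentiableAt ℝ g x) :
    pd l (fun y => f y + g y) x = pd l f x + pd l g x := by
  unfold pd; rw [fderiv_fun_add hf hg]; rfl

theorem pd_mul {N : ℕ} {l : Fin N} {f g : (Fin N → ℝ) → ℝ} {x : Fin N → ℝ}
    (hf : DifferentiableAt ℝ f x) (hg : DifferentiableAt ℝ g x) :
    pd l (fun y => f y * g y) x = pd l f x * g x + f x * pd l g x := by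
  unfold pd; rw [fderiv_fun_mul hf hg]; simp; ring

namespace Jet

variable {N : ℕ} {k l : Fin N} {f g : (Fin N → ℝ) → ℝ} {a b c d a' b' c' d' : ℝ}

theorem congr (h : Jet k l f a b c d) (ha : a = a') (hb : b = b') (hc : c = c') (hd : d = d') :
    Jet k l f a' b' c' d' := by subst ha hb hc hd; exact h

theorem const (a : ℝ) : Jet k l (fun _ => a) a 0 0 0 := by
  have h : ∀ (i : Fin N) (a : ℝ), pd i (fun _ : Fin N → ℝ => a) = fun _ => 0 := by
    intro i a; funext x; simp [pd]
  refine ⟨contDiffAt_const, rfl, ?_, ?_, ?_⟩ <;> simp [h]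

theorem add (hf : Jet k l f a b c d) (hg : Jet k l g a' b' c' d') :
    Jet k l (fun x => f x + g x) (a + a') (b + b') (c + c') (d + d') := by
  have Df := hf.smooth.differentiableAt (by norm_num)
  have Dg := hg.smooth.differentiableAt (by norm_num)
  refine ⟨hf.smooth.add hg.smooth, by rw [hf.val, hg.val], by rw [pd_add Df Dg, hf.d1, hg.d1],
    by rw [pd_add Df Dg, hf.d2, hg.d2], ?_⟩
  have : pd l (fun x => f x + g x) =ᶠ[nhds 0] fun x => pd l f x + pd l g x := by
    filter_upwards [ev_diff hf.smooth, ev_diff hg.smooth] with y h1 h2 using pd_add h1 h2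
  rw [pd_congr this, pd_add ((pd_contDiffAt hf.smooth).differentiableAt (by norm_num))
    ((pd_contDiffAt hg.smooth).differentiableAt (by norm_num)), hf.d12, hg.d12]

theorem mul (hf : Jet k l f a b c d) (hg : Jet k l g a' b' c' d') :
    Jet k l (fun x => f x * g x) (a * a') (b * a' + a * b') (c * a' + a * c')
      (d * a' + c * b' + b * c' + a * d') := by
  have Df := hf.smooth.differentiableAt (by norm_num)
  have Dg := hg.smooth.differentiableAt (by norm_num)
  have Pf := (pd_contDiffAt (l := l) hf.smooth).differentiableAt (by norm_num)
  have Pg := (pd_contDiffAt (l := l) hg.smooth).differentiableAt (by norm_num)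
  refine ⟨hf.smooth.mul hg.smooth, by rw [hf.val, hg.val],
    by rw [pd_mul Df Dg, hf.d1, hg.d1, hf.val, hg.val],
    by rw [pd_mul Df Dg, hf.d2, hg.d2, hf.val, hg.val], ?_⟩
  have : pd l (fun x => f x * g x) =ᶠ[nhds 0] fun x => pd l f x * g x + f x * pd l g x := by
    filter_upwards [ev_diff hf.smooth, ev_diff hg.smooth] with y h1 h2 using pd_mul h1 h2
  rw [pd_congr this, pd_add (f := fun x => pd l f x * g x) (g := fun x => f x * pd l g x) (Pf.mul Dg) (Df.mul Pg), pd_mul Pf Dg, pd_mul Df Pg,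
    hf.d12, hg.d12, hf.d1, hf.d2, hg.d1, hg.d2, hf.val, hg.val]
  ring

theorem const_mul (r : ℝ) (hf : Jet k l f a b c d) :
    Jet k l (fun x => r * f x) (r * a) (r * b) (r * c) (r * d) :=
  ((const r).mul hf).congr rfl (by ring) (by ring) (by ring)

theorem neg (hf : Jet k l f a b c d) :
    Jet k l (fun x => - f x) (-a) (-b) (-c) (-d) := by
  simpa using hf.const_mul (-1)

theorem sub (hf : Jet k l f a b c d) (hg : Jet k l g a' b' c' d') :
    Jet k l (fun x => f x - g x) (a - a') (b - b') (c - c') (d - d') := by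
  simpa [sub_eq_add_neg] using hf.add hg.neg

theorem sum {ι : Type} (s : Finset ι) {f : ι → (Fin N → ℝ) → ℝ} {a b c d : ι → ℝ}
    (h : ∀ i, Jet k l (f i) (a i) (b i) (c i) (d i)) :
    Jet k l (fun x => ∑ i ∈ s, f i x) (∑ i ∈ s, a i) (∑ i ∈ s, b i) (∑ i ∈ s, c i)
      (∑ i ∈ s, d i) := by
  classical
  induction s using Finset.induction_on with
  | empty => simpa using const 0
  | insert i s hi ih => simpa [Finset.sum_insert hi] using (h i).add ih

end Jet

theorem snoc_eq {m : ℕ} (x' : Fin m → ℝ) (s : ℝ) :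
    (Fin.snoc x' s : Fin (m + 1) → ℝ)
      = Fin.snoc x' (0 : ℝ) + s • (Pi.single (Fin.last m) 1 : Fin (m + 1) → ℝ) := by
  funext i
  refine Fin.lastCases ?_ (fun j => ?_) i
  · simp
  · simp

theorem pd_snoc {m N : ℕ} (l : Fin N) {h : (Fin (m + 1) → ℝ) → ℝ} (hh : Differentiable ℝ h)
    (x' : Fin m → ℝ) {f : (Fin N → ℝ) → ℝ} {x : Fin N → ℝ} (hf : DifferentiableAt ℝ f x) :
    pd l (fun ε => h (Fin.snoc x' (f ε))) x
      = pd (Fin.last m) h (Fin.snoc x' (f x)) * pd l f x := by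
  have h1 : HasFDerivAt (fun ε => (Fin.snoc x' (f ε) : Fin (m + 1) → ℝ))
      ((fderiv ℝ f x).smulRight (Pi.single (Fin.last m) 1 : Fin (m + 1) → ℝ)) x := by
    have := (hf.hasFDerivAt.smul_const
      (Pi.single (Fin.last m) 1 : Fin (m + 1) → ℝ)).const_add (Fin.snoc x' (0 : ℝ))
    refine this.congr_of_eventuallyEq (Filter.Eventually.of_forall fun ε => ?_)
    exact snoc_eq x' (f ε)
  have h2 := (hh (Fin.snoc x' (f x))).hasFDerivAt.comp x h1
  unfold pd
  have h3 : fderiv ℝ (fun ε => h (Fin.snoc x' (f ε))) x = _ := h2.fderiv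
  rw [h3]
  simp [mul_comm]

theorem pd_smooth {N : ℕ} {l : Fin N} {f : (Fin N → ℝ) → ℝ}
    (hf : ContDiff ℝ (⊤ : ℕ∞) f) : ContDiff ℝ (⊤ : ℕ∞) (pd l f) :=
  (hf.fderiv_right (m := (⊤ : ℕ∞)) (by simp)).clm_apply contDiff_const

theorem Jet.snoc {m N : ℕ} {k l : Fin N} {h : (Fin (m + 1) → ℝ) → ℝ}
    (hh : ContDiff ℝ (⊤ : ℕ∞) h) (x' : Fin m → ℝ) {f : (Fin N → ℝ) → ℝ} {a b c d : ℝ}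
    (hf : Jet k l f a b c d) :
    Jet k l (fun ε => h (Fin.snoc x' (f ε))) (h (Fin.snoc x' a))
      (pd (Fin.last m) h (Fin.snoc x' a) * b)
      (pd (Fin.last m) h (Fin.snoc x' a) * c)
      (pd (Fin.last m) (pd (Fin.last m) h) (Fin.snoc x' a) * b * c
        + pd (Fin.last m) h (Fin.snoc x' a) * d) := by
  have Df := hf.smooth.differentiableAt (by norm_num)
  have Pf := (pd_contDiffAt (l := l) hf.smooth).differentiableAt (by norm_num)
  have Dh : Differentiable ℝ h := hh.differentiable (by simp)
  have Dh' : Differentiable ℝ (pd (Fin.last m) h) := (pd_smooth hh).differentiable (by simp)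
  have sm : ∀ (h : (Fin (m + 1) → ℝ) → ℝ) (hh : ContDiff ℝ (⊤ : ℕ∞) h),
      ContDiffAt ℝ 2 (fun ε => h (Fin.snoc x' (f ε))) 0 := by
    intro h hh
    have h1 : ContDiffAt ℝ 2 (fun ε => (Fin.snoc x' (f ε) : Fin (m + 1) → ℝ)) 0 := by
      have : (fun ε => (Fin.snoc x' (f ε) : Fin (m + 1) → ℝ)) = fun ε => 
          Fin.snoc x' (0 : ℝ) + f ε • (Pi.single (Fin.last m) 1 : Fin (m + 1) → ℝ) := by
        funext ε; exact snoc_eq x' (f ε)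
      rw [this]
      exact contDiffAt_const.add (hf.smooth.smul contDiffAt_const)
    exact ContDiffAt.comp (𝕜 := ℝ) (n := 2) (g := h) 0
      ((hh.of_le two_le_top).contDiffAt) h1
  refine ⟨sm h hh, by rw [hf.val], by rw [pd_snoc k Dh x' Df, hf.val, hf.d1],
    by rw [pd_snoc l Dh x' Df, hf.val, hf.d2], ?_⟩
  have : pd l (fun ε => h (Fin.snoc x' (f ε))) =ᶠ[nhds 0]
      fun ε => pd (Fin.last m) h (Fin.snoc x' (f ε)) * pd l f ε := by
    filter_upwards [ev_diff hf.smooth] with y h1 using pd_snoc l Dh x' h1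
  rw [pd_congr this, pd_mul ((sm _ (pd_smooth hh)).differentiableAt (by norm_num)) Pf,
    pd_snoc k Dh' x' Df, hf.val, hf.d1, hf.d2, hf.d12]

theorem pd_comm {N : ℕ} {i j : Fin N} {f : (Fin N → ℝ) → ℝ}
    (hf : ContDiff ℝ (⊤ : ℕ∞) f) (x : Fin N → ℝ) : pd i (pd j f) x = pd j (pd i f) x := by
  have hs := (hf.contDiffAt (x := x)).isSymmSndFDerivAt (by simpa using two_le_top)
  have hd : DifferentiableAt ℝ (fderiv ℝ f) x :=
    ((hf.fderiv_right (m := (⊤ : ℕ∞)) (by simp)).differentiable (by simp)) x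
  have key : ∀ i j : Fin N, pd i (pd j f) x
      = fderiv ℝ (fderiv ℝ f) x (Pi.single i 1) (Pi.single j 1) := by
    intro i j
    have : fderiv ℝ (fun y => fderiv ℝ f y (Pi.single j 1)) x = _ :=
      (hd.hasFDerivAt.clm_apply (hasFDerivAt_const (Pi.single j (1 : ℝ)) x)).fderiv
    change fderiv ℝ (fun y => fderiv ℝ f y (Pi.single j 1)) x (Pi.single i 1) = _
    rw [this]; simp
  rw [key, key, hs.eq]

/-- Joint smoothness over `V`. -/
def JS {N m : ℕ} (V : Set (Fin N → ℝ)) (Φ : (Fin N → ℝ) → (Fin m → ℝ) → ℝ) : Prop :=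
  ∀ ε ∈ V, ∀ x, ContDiffAt ℝ (⊤ : ℕ∞) (fun p : (Fin N → ℝ) × (Fin m → ℝ) => Φ p.1 p.2) (ε, x)

section JSsec
variable {N m : ℕ} {V : Set (Fin N → ℝ)} {Φ : (Fin N → ℝ) → (Fin m → ℝ) → ℝ}

theorem slice_x {i : Fin m} {ε : Fin N → ℝ} {x : Fin m → ℝ}
    (h : DifferentiableAt ℝ (fun p : (Fin N → ℝ) × (Fin m → ℝ) => Φ p.1 p.2) (ε, x)) :
    pd i (Φ ε) x = fderiv ℝ (fun p : (Fin N → ℝ) × (Fin m → ℝ) => Φ p.1 p.2) (ε, x)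
      (0, Pi.single i 1) := by
  have h1 : fderiv ℝ (Φ ε) x = _ :=
    (h.hasFDerivAt.comp x (hasFDerivAt_prodMk_right ε x)).fderiv
  unfold pd; rw [h1]; simp

theorem slice_e {i : Fin N} {ε : Fin N → ℝ} {x : Fin m → ℝ}
    (h : DifferentiableAt ℝ (fun p : (Fin N → ℝ) × (Fin m → ℝ) => Φ p.1 p.2) (ε, x)) :
    pd i (fun ε' => Φ ε' x) ε
      = fderiv ℝ (fun p : (Fin N → ℝ) × (Fin m → ℝ) => Φ p.1 p.2) (ε, x)
      (Pi.single i 1, 0) := by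
  have h1 : fderiv ℝ (fun ε' => Φ ε' x) ε = _ :=
    (HasFDerivAt.comp (f := fun ε' => (ε', x)) ε h.hasFDerivAt
      (hasFDerivAt_prodMk_left ε x)).fderiv
  unfold pd; rw [h1]; simp

theorem JS.diff (h : JS V Φ) {ε : Fin N → ℝ} (hε : ε ∈ V) (x : Fin m → ℝ) :
    DifferentiableAt ℝ (fun p : (Fin N → ℝ) × (Fin m → ℝ) => Φ p.1 p.2) (ε, x) :=
  (h ε hε x).differentiableAt (by simp)

theorem ev_V (hV : IsOpen V) {ε : Fin N → ℝ} (hε : ε ∈ V) (x : Fin m → ℝ) :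
    ∀ᶠ p : (Fin N → ℝ) × (Fin m → ℝ) in nhds (ε, x), p.1 ∈ V :=
  continuous_fst.continuousAt.eventually (hV.mem_nhds hε)

theorem JS.dx (hV : IsOpen V) (h : JS V Φ) (i : Fin m) : JS V (fun ε => pd i (Φ ε)) := by
  intro ε hε x
  have h1 := (((h ε hε x).fderiv_right (m := (⊤ : ℕ∞)) (by simp)).clm_apply
    (contDiffAt_const (c := ((0 : Fin N → ℝ), (Pi.single i 1 : Fin m → ℝ)))))
  refine h1.congr_of_eventuallyEq ?_
  filter_upwards [ev_V hV hε x] with p hp using slice_x (h.diff hp p.2)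

theorem JS.de (hV : IsOpen V) (h : JS V Φ) (i : Fin N) :
    JS V (fun ε x => pd i (fun ε' => Φ ε' x) ε) := by
  intro ε hε x
  have h1 := (((h ε hε x).fderiv_right (m := (⊤ : ℕ∞)) (by simp)).clm_apply
    (contDiffAt_const (c := ((Pi.single i 1 : Fin N → ℝ), (0 : Fin m → ℝ)))))
  refine h1.congr_of_eventuallyEq ?_
  filter_upwards [ev_V hV hε x] with p hp using slice_e (h.diff hp p.2)

theorem JS.comm (hV : IsOpen V) (h : JS V Φ) (i : Fin m) (k : Fin N) {ε : Fin N → ℝ}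
    (hε : ε ∈ V) (x : Fin m → ℝ) :
    pd k (fun ε' => pd i (Φ ε') x) ε = pd i (fun y => pd k (fun ε' => Φ ε' y) ε) x := by
  have hd : DifferentiableAt ℝ (fderiv ℝ (fun p : (Fin N → ℝ) × (Fin m → ℝ) => Φ p.1 p.2))
      (ε, x) := ((h ε hε x).fderiv_right (m := (⊤ : ℕ∞)) (by simp)).differentiableAt (by simp)
  have key : ∀ v : (Fin N → ℝ) × (Fin m → ℝ), HasFDerivAt
      (fun p => fderiv ℝ (fun p : (Fin N → ℝ) × (Fin m → ℝ) => Φ p.1 p.2) p v) _ (ε, x) :=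
    fun v => hd.hasFDerivAt.clm_apply (hasFDerivAt_const v (ε, x))
  have hs := (h ε hε x).isSymmSndFDerivAt (by simpa using two_le_top)
  rw [slice_e (Φ := fun ε' => pd i (Φ ε')) ((h.dx hV i).diff hε x),
    slice_x (Φ := fun ε y => pd k (fun ε' => Φ ε' y) ε) ((h.de hV k).diff hε x)]
  have e1 : (fun p : (Fin N → ℝ) × (Fin m → ℝ) => pd i (Φ p.1) p.2) =ᶠ[nhds (ε, x)]
      fun p => fderiv ℝ (fun p : (Fin N → ℝ) × (Fin m → ℝ) => Φ p.1 p.2) p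
        (0, Pi.single i 1) := by
    filter_upwards [ev_V hV hε x] with p hp using slice_x (h.diff hp p.2)
  have e2 : (fun p : (Fin N → ℝ) × (Fin m → ℝ) => pd k (fun ε' => Φ ε' p.2) p.1) =ᶠ[nhds (ε, x)]
      fun p => fderiv ℝ (fun p : (Fin N → ℝ) × (Fin m → ℝ) => Φ p.1 p.2) p
        (Pi.single k 1, 0) := by
    filter_upwards [ev_V hV hε x] with p hp using slice_e (h.diff hp p.2)
  rw [e1.fderiv_eq, e2.fderiv_eq, (key _).fderiv, (key _).fderiv]
  simpa using hs.eq _ _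

theorem JS.comm2 (hV : IsOpen V) (h : JS V Φ) (i : Fin m) (k l : Fin N) {ε : Fin N → ℝ}
    (hε : ε ∈ V) (x : Fin m → ℝ) :
    pd k (fun ε => pd l (fun ε' => pd i (Φ ε') x) ε) ε
      = pd i (fun y => pd k (fun ε => pd l (fun ε' => Φ ε' y) ε) ε) x := by
  have e : (fun ε => pd l (fun ε' => pd i (Φ ε') x) ε) =ᶠ[nhds ε]
      fun ε => pd i (fun y => pd l (fun ε' => Φ ε' y) ε) x := by
    filter_upwards [hV.mem_nhds hε] with ε' hε' using h.comm hV i l hε' x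
  rw [pd_congr e]
  exact (h.de hV l).comm hV i k hε x

theorem JS.jet (h : JS V Φ) (h0 : (0 : Fin N → ℝ) ∈ V) (k l : Fin N) (x : Fin m → ℝ) :
    Jet k l (fun ε => Φ ε x) (Φ 0 x) (pd k (fun ε => Φ ε x) 0) (pd l (fun ε => Φ ε x) 0)
      (pd k (fun ε => pd l (fun ε' => Φ ε' x) ε) 0) := by
  refine ⟨?_, rfl, rfl, rfl, rfl⟩
  have h1 : ContDiffAt ℝ 2 (fun p : (Fin N → ℝ) × (Fin m → ℝ) => Φ p.1 p.2) (0, x) :=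
    (h 0 h0 x).of_le two_le_top
  exact ContDiffAt.comp (𝕜 := ℝ) (n := 2) (0 : Fin N → ℝ)
    (g := fun p : (Fin N → ℝ) × (Fin m → ℝ) => Φ p.1 p.2) (f := fun ε => (ε, x)) h1
    (contDiffAt_id.prodMk contDiffAt_const)

end JSsec

/-- Second linearization of the minimal surface equation at the zero solution: if
`∂_n c(x', 0) = 0` and `∂_k ∂_n c(x', 0) = 0` for `k < n`, `u_ε` (`ε ∈ ℝ^N`) is a smooth
family with `u_0 ≡ 0`, `v^k = ∂_{ε_k} u_ε|_{ε=0}`, `v^l = ∂_{ε_l} u_ε|_{ε=0}` and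
`w = ∂²_{ε_k ε_l} u_ε|_{ε=0}` (`k ≠ l`), then
`∂²_{ε_k ε_l}[F(x', u_ε, ∇ u_ε, ∇² u_ε)]|_{ε=0}
  = −Δ_ĝ w + ((n−1)/(2c(x',0))) (∂³_n c(x',0) v^k v^l + ∂²_n c(x',0) w)
    + ((1−n)/(2c(x',0))) Σ_{i,j} ĝ^{ij} ∂_i c(x',0) ∂_j w`, where `n = m+1`. -/
theorem second_linearization_mse (m : ℕ) (hm : 2 ≤ m)
    (ghat : (Fin m → ℝ) → Matrix (Fin m) (Fin m) ℝ)
    (hghat : ∀ i j, ContDiff ℝ (⊤ : ℕ∞) fun x' => ghat x' i j)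
    (hpd : ∀ x', (ghat x').PosDef)
    (c : (Fin (m + 1) → ℝ) → ℝ)
    (hc : ContDiff ℝ (⊤ : ℕ∞) c) (hcpos : ∀ x, 0 < c x)
    (hcn : ∀ x' : Fin m → ℝ, pd (Fin.last m) c (Fin.snoc x' (0 : ℝ)) = 0)
    (hcmix : ∀ (x' : Fin m → ℝ) (k : Fin m),
      pd (Fin.castSucc k) (pd (Fin.last m) c) (Fin.snoc x' (0 : ℝ)) = 0)
    (N : ℕ) (k l : Fin N) (hkl : k ≠ l)
    (u : (Fin N → ℝ) → (Fin m → ℝ) → ℝ)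
    (hu : ∃ U ∈ nhds (0 : Fin N → ℝ),
      ContDiffOn ℝ (⊤ : ℕ∞) (fun p : (Fin N → ℝ) × (Fin m → ℝ) => u p.1 p.2)
        (U ×ˢ Set.univ))
    (hu0 : u 0 = fun _ => 0)
    (x' : Fin m → ℝ) :
    pd k (fun ε => pd l (fun ε' => Fop c ghat (u ε') x' (Fin.snoc x' (u ε' x'))) ε)
        (0 : Fin N → ℝ)
      = -(laplaceB ghat
            (fun y => pd k (fun ε => pd l (fun ε' => u ε' y) ε) (0 : Fin N → ℝ)) x')
        + ((((m : ℝ) + 1) - 1) / (2 * c (Fin.snoc x' (0 : ℝ)))) *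
            (pd (Fin.last m) (pd (Fin.last m) (pd (Fin.last m) c)) (Fin.snoc x' (0 : ℝ))
                * pd k (fun ε => u ε x') (0 : Fin N → ℝ)
                * pd l (fun ε => u ε x') (0 : Fin N → ℝ)
              + pd (Fin.last m) (pd (Fin.last m) c) (Fin.snoc x' (0 : ℝ))
                * pd k (fun ε => pd l (fun ε' => u ε' x') ε) (0 : Fin N → ℝ))
        + ((1 - ((m : ℝ) + 1)) / (2 * c (Fin.snoc x' (0 : ℝ)))) *
            ∑ i : Fin m, ∑ j : Fin m,
              (ghat x')⁻¹ i j * pd (Fin.castSucc i) c (Fin.snoc x' (0 : ℝ))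
                * pd j (fun y => pd k (fun ε => pd l (fun ε' => u ε' y) ε)
                    (0 : Fin N → ℝ)) x' := by
  obtain ⟨U, hU, huU⟩ := hu
  obtain ⟨V, hVU, hV, h0⟩ := mem_nhds_iff.1 hU
  have hJS : JS V u := by
    intro ε hε x
    refine huU.contDiffAt ?_
    exact prod_mem_nhds (Filter.mem_of_superset (hV.mem_nhds hε) hVU) Filter.univ_mem
  have z1 : ∀ (j : Fin m), pd j (u 0) = fun _ => 0 := by
    intro j; rw [hu0]; funext x; simp [pd]
  have z2 : ∀ (i j : Fin m), pd i (pd j (u 0)) x' = 0 := by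
    intro i j; rw [z1]; simp [pd]
  have Ju := hJS.jet h0 k l x'
  rw [hu0] at Ju
  simp only at Ju
  have Jp : ∀ j : Fin m, ∃ b c, Jet k l (fun ε => pd j (u ε) x') 0 b c
      (pd j (fun y => pd k (fun ε => pd l (fun ε' => u ε' y) ε) (0 : Fin N → ℝ)) x') := by
    intro j
    exact ⟨_, _, ((hJS.dx hV j).jet h0 k l x').congr (by simp [z1]) rfl rfl
      (hJS.comm2 hV j k l h0 x')⟩
  have Jpp : ∀ i j : Fin m, ∃ b c, Jet k l (fun ε => pd i (pd j (u ε)) x') 0 b c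
      (pd i (pd j (fun y => pd k (fun ε => pd l (fun ε' => u ε' y) ε) (0 : Fin N → ℝ))) x') := by
    intro i j
    refine ⟨_, _, (((hJS.dx hV j).dx hV i).jet h0 k l x').congr (z2 i j) rfl rfl ?_⟩
    rw [(hJS.dx hV j).comm2 hV i k l h0 x']
    congr 1
    funext y
    exact hJS.comm2 hV j k l h0 y
  generalize (fun y => pd k (fun ε => pd l (fun ε' => u ε' y) ε) (0 : Fin N → ℝ)) = w at *
  choose pb pc Jp using Jp
  choose qb qc Jpp using Jpp
  -- Hessian
  have JH : ∀ i j : Fin m, ∃ b c, Jet k l (fun ε => hessian ghat (u ε) i j x') 0 b c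
      (hessian ghat w i j x') := by
    intro i j
    exact ⟨_, _, ((Jpp i j).sub (Jet.sum Finset.univ
      (fun r => (Jp r).const_mul (christoffel ghat r i j x')))).congr (by simp) rfl rfl rfl⟩
  choose hb hc' JH using JH
  have JL := Jet.sum Finset.univ (fun i => Jet.sum Finset.univ
      (fun j => (JH i j).const_mul ((ghat x')⁻¹ i j)))
  have JC : ∀ i : Fin m, ∃ b c d, Jet k l (fun ε => gradC ghat (u ε) i x') 0 b c d := by
    intro i
    exact ⟨_, _, _, (Jet.sum Finset.univ
      (fun j => (Jp j).const_mul ((ghat x')⁻¹ i j))).congr (by simp) rfl rfl rfl⟩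
  choose cb cc cd JC using JC
  have JG : ∃ d, Jet k l (fun ε => gradSq ghat (u ε) x') 0 0 0 d :=
    ⟨_, (Jet.sum Finset.univ (fun i => Jet.sum Finset.univ
      (fun j => ((Jp i).const_mul ((ghat x')⁻¹ i j)).mul (Jp j)))).congr
        (by simp) (by simp) (by simp) rfl⟩
  obtain ⟨gd, JG⟩ := JG
  have JT : Jet k l (fun ε => ∑ i : Fin m, ∑ j : Fin m,
      hessian ghat (u ε) i j x' * gradC ghat (u ε) i x' * gradC ghat (u ε) j x') 0 0 0 0 :=
    (Jet.sum Finset.univ (fun i => Jet.sum Finset.univ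
      (fun j => ((JH i j).mul (JC i)).mul (JC j)))).congr
        (by simp) (by simp) (by simp) (by simp)
  have Jinv : ∀ κ : ℝ, ∃ d, Jet k l (fun ε => κ / (2 * c (Fin.snoc x' (u ε x'))))
      (κ / (2 * c (Fin.snoc x' (0 : ℝ)))) 0 0 d := by
    intro κ
    have hs : ContDiff ℝ (⊤ : ℕ∞) (fun x => κ / (2 * c x)) :=
      contDiff_const.div (contDiff_const.mul hc) (fun x => by have := hcpos x; positivity)
    have hz : pd (Fin.last m) (fun x => κ / (2 * c x)) (Fin.snoc x' (0 : ℝ)) = 0 := by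
      have D1 : DifferentiableAt ℝ c (Fin.snoc x' (0 : ℝ)) := hc.differentiable (by simp) _
      have D2 : DifferentiableAt ℝ (fun x => κ / (2 * c x)) (Fin.snoc x' (0 : ℝ)) :=
        hs.differentiable (by simp) _
      have e := pd_mul (l := Fin.last m) D2 D1
      have e2 : (fun x => κ / (2 * c x) * c x) = fun _ => κ / 2 := by
        funext x; have := (hcpos x).ne'; field_simp
      rw [e2, hcn x', mul_zero, add_zero] at e
      have e3 : pd (Fin.last m) (fun _ : Fin (m + 1) → ℝ => κ / 2) (Fin.snoc x' (0 : ℝ)) = 0 := by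
        simp [pd]
      rw [e3] at e
      exact (mul_eq_zero.1 e.symm).resolve_right (hcpos _).ne'
    exact ⟨_, (Jet.snoc hs x' Ju).congr rfl (by rw [hz, zero_mul]) (by rw [hz, zero_mul]) rfl⟩
  have Jr : ∀ r : Fin m, ∃ d, Jet k l
      (fun ε => pd (Fin.castSucc r) c (Fin.snoc x' (u ε x')))
      (pd (Fin.castSucc r) c (Fin.snoc x' (0 : ℝ))) 0 0 d := by
    intro r
    have hz : pd (Fin.last m) (pd (Fin.castSucc r) c) (Fin.snoc x' (0 : ℝ)) = 0 := by
      rw [pd_comm hc, hcmix]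
    exact ⟨_, (Jet.snoc (pd_smooth hc) x' Ju).congr rfl (by rw [hz, zero_mul])
      (by rw [hz, zero_mul]) rfl⟩
  choose rd Jr using Jr
  obtain ⟨d1, J1⟩ := Jinv (1 - ((m : ℝ) + 1))
  obtain ⟨d2, J2⟩ := Jinv (((m : ℝ) + 1) - 1)
  have Jn := Jet.snoc (pd_smooth (l := Fin.last m) hc) x' Ju
  have JS1 := Jet.sum Finset.univ (fun mm => Jet.sum Finset.univ
      (fun r => ((Jr r).const_mul ((ghat x')⁻¹ mm r)).mul (Jp mm)))
  have J := ((((JL.neg).add (J1.mul JS1)).add (J2.mul Jn)).mul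
    ((Jet.const 1).add JG)).add JT
  have key := J.d12
  have hsymm : ∀ i j, (ghat x')⁻¹ i j = (ghat x')⁻¹ j i := by
    intro i j
    have := (hpd x').inv.isHermitian.apply i j
    simpa using this.symm
  have hsum : ∑ i : Fin m, ∑ j : Fin m,
              (ghat x')⁻¹ i j * pd (Fin.castSucc i) c (Fin.snoc x' (0 : ℝ)) * pd j w x'
      = ∑ i : Fin m, ∑ j : Fin m,
              (ghat x')⁻¹ i j * pd (Fin.castSucc j) c (Fin.snoc x' (0 : ℝ)) * pd i w x' := by
    rw [Finset.sum_comm]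
    refine Finset.sum_congr rfl fun i _ => Finset.sum_congr rfl fun j _ => ?_
    rw [hsymm j i]
  rw [hsum]
  refine key.trans ?_
  simp only [hcn x', laplaceB, hessian, mul_zero, zero_mul, add_zero, zero_add,
    Finset.sum_const_zero, mul_one, neg_zero]
  try ring
end
end
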